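/- arXiv:math/0407041 — 4 statements merged into one kernel-verified Lean document; each statement's English description precedes it below -/
import Mathlib

section
/- Let A be a graded algebra over a field k generated in degree 1, and let I ⊆ A be a homogeneous ideal generated by forms of degree at most d. Fix positive integers e and c with c ≥ de+1. Then for all positive integers s and t, (I^{es})_{cs} · (I^{et})_{ct} = (I^{e(s+t)})_{c(s+t)}, where the left-hand side is the k-span of products. Consequently the diagonal subalgebra ⊕_{s≥0}(I^{es})_{cs} of the Rees algebra coincides with the k-subalgebra k[(I^e)_c] of A generated by the vector space (I^e)_c. -/
open scoped Pointwise

namespace StandardGraded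

variable {k A : Type*} [Field k] [CommRing A] [Algebra k A] (𝒜 : ℕ → Submodule k A)

theorem component_add [GradedAlgebra 𝒜] (hzero : 𝒜 0 ≤ 1)
    (hstd : ∀ n : ℕ, 𝒜 (n + 1) =
      Submodule.span k (Set.image2 (· * ·) (𝒜 1 : Set A) (𝒜 n : Set A))) (m n : ℕ) :
    𝒜 (m + n) = 𝒜 m * 𝒜 n := by
  have hstd' (n : ℕ) : 𝒜 (n + 1) = 𝒜 1 * 𝒜 n := by
    rw [hstd, Submodule.mul_eq_span_mul_set]
    rfl
  induction m with
  | zero =>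
    have h : 𝒜 0 = 1 := le_antisymm hzero (Submodule.one_le.2 SetLike.GradedOne.one_mem)
    rw [h, one_mul, zero_add]
  | succ m ih => rw [Nat.add_right_comm, hstd' (m + n), ih, hstd' m, mul_assoc]

/-- A homogeneous element of an ideal generated by forms is a `k`-linear combination of products
of a generator and a form of complementary degree. -/
theorem mem_of_mem_span_of_mem [GradedAlgebra 𝒜] {S : Set A} {n : ℕ} {M : Submodule k A}
    (hS : ∀ f ∈ S, ∃ i, f ∈ 𝒜 i ∧ ∀ j, i + j = n → ∀ g ∈ 𝒜 j, f * g ∈ M)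
    {x : A} (hx : x ∈ Ideal.span S) (hxn : x ∈ 𝒜 n) : x ∈ M := by
  have key : ∀ a : A, (DirectSum.decompose 𝒜 (a * x) n : A) ∈ M := by
    clear hxn
    induction hx using Submodule.span_induction with
    | mem f hf =>
      intro a
      obtain ⟨i, hi, h⟩ := hS f hf
      by_cases hin : i ≤ n
      · rw [DirectSum.coe_decompose_mul_of_right_mem_of_le 𝒜 hi hin, mul_comm]
        exact h (n - i) (by omega) _ (SetLike.coe_mem _)
      · rw [DirectSum.coe_decompose_mul_of_right_mem_of_not_le 𝒜 hi hin]
        exact M.zero_mem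
    | zero => simp
    | add x y _ _ hx hy =>
      intro a
      rw [mul_add, DirectSum.decompose_add, DirectSum.add_apply, Submodule.coe_add]
      exact M.add_mem (hx a) (hy a)
    | smul b x _ hx =>
      intro a
      rw [smul_eq_mul, ← mul_assoc]
      exact hx (a * b)
  simpa [DirectSum.decompose_of_mem_same 𝒜 hxn] using key 1

theorem exists_degree_le_of_mem_pow [SetLike.GradedMonoid 𝒜] {T : Set A} {d : ℕ}
    (hT : ∀ f ∈ T, ∃ i ≤ d, f ∈ 𝒜 i) (n : ℕ) :
    ∀ f ∈ T ^ n, ∃ i ≤ d * n, f ∈ 𝒜 i := by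
  induction n with
  | zero =>
    intro f hf
    rw [pow_zero, Set.mem_one] at hf
    exact ⟨0, le_rfl, hf ▸ SetLike.GradedOne.one_mem⟩
  | succ n ih =>
    intro f hf
    rw [pow_succ] at hf
    obtain ⟨g, hg, h, hh, rfl⟩ := Set.mem_mul.1 hf
    obtain ⟨i, hi, hgi⟩ := ih g hg
    obtain ⟨j, hj, hhj⟩ := hT h hh
    exact ⟨i + j, by rw [mul_add_one]; omega, SetLike.mul_mem_graded hgi hhj⟩

theorem pow_inf_component_mul [GradedAlgebra 𝒜] (hzero : 𝒜 0 ≤ 1)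
    (hstd : ∀ n : ℕ, 𝒜 (n + 1) =
      Submodule.span k (Set.image2 (· * ·) (𝒜 1 : Set A) (𝒜 n : Set A)))
    {T : Set A} {d : ℕ} (hT : ∀ f ∈ T, ∃ i ≤ d, f ∈ 𝒜 i) {p q m n : ℕ}
    (hm : d * p ≤ m) (hn : d * q ≤ n) :
    (Submodule.restrictScalars k (Ideal.span T ^ p) ⊓ 𝒜 m) *
        (Submodule.restrictScalars k (Ideal.span T ^ q) ⊓ 𝒜 n) =
      Submodule.restrictScalars k (Ideal.span T ^ (p + q)) ⊓ 𝒜 (m + n) := by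
  have hpow (r : ℕ) : Ideal.span T ^ r = Ideal.span (T ^ r) := Submodule.span_pow T r
  apply le_antisymm
  · rw [Submodule.mul_le]
    rintro x ⟨hx, hxm⟩ y ⟨hy, hyn⟩
    refine ⟨?_, SetLike.mul_mem_graded hxm hyn⟩
    rw [pow_add]
    exact Ideal.mul_mem_mul hx hy
  · rintro x ⟨hx, hxmn⟩
    have hx' : x ∈ Ideal.span (T ^ (p + q)) := by
      rw [← hpow]
      exact hx
    refine mem_of_mem_span_of_mem 𝒜 ?_ hx' hxmn
    intro f hf
    rw [pow_add] at hf
    obtain ⟨u, hu, v, hv, rfl⟩ := Set.mem_mul.1 hf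
    obtain ⟨a, ha, hua⟩ := exists_degree_le_of_mem_pow 𝒜 hT p u hu
    obtain ⟨b, hb, hvb⟩ := exists_degree_le_of_mem_pow 𝒜 hT q v hv
    refine ⟨a + b, SetLike.mul_mem_graded hua hvb, fun j hj g hg ↦ ?_⟩
    obtain rfl : j = (m - a) + (n - b) := by omega
    rw [component_add 𝒜 hzero hstd] at hg
    induction hg using Submodule.mul_induction_on' with
    | mem_mul_mem g hg h hh =>
      rw [mul_mul_mul_comm]
      refine Submodule.mul_mem_mul ⟨?_, ?_⟩ ⟨?_, ?_⟩
      · exact Ideal.mul_mem_right _ _ (hpow p ▸ Ideal.subset_span hu)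
      · have := SetLike.mul_mem_graded hua hg
        rwa [Nat.add_sub_cancel' (ha.trans hm)] at this
      · exact Ideal.mul_mem_right _ _ (hpow q ▸ Ideal.subset_span hv)
      · have := SetLike.mul_mem_graded hvb hh
        rwa [Nat.add_sub_cancel' (hb.trans hn)] at this
    | add y _ z _ hy hz =>
      rw [mul_add]
      exact add_mem hy hz

end StandardGraded

theorem toSubmodule_adjoin_eq_iSup_pow {R B : Type*} [CommSemiring R] [Semiring B] [Algebra R B]
    (M : Submodule R B) :
    Subalgebra.toSubmodule (Algebra.adjoin R (M : Set B)) = ⨆ n : ℕ, M ^ n := by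
  apply le_antisymm
  · rw [Algebra.adjoin_eq_span, Submodule.span_le]
    intro x hx
    induction hx using Submonoid.closure_induction_left with
    | one => exact Submodule.mem_iSup_of_mem 0 (by simp [Submodule.one_le.1])
    | mul_left x hx y _ hy =>
      have h : M * ⨆ n : ℕ, M ^ n ≤ ⨆ n : ℕ, M ^ n := by
        rw [Submodule.mul_iSup]
        exact iSup_le fun n ↦ (pow_succ' M n).symm.le.trans (le_iSup (fun n : ℕ ↦ M ^ n) (n + 1))
      exact h (Submodule.mul_mem_mul hx hy)
  · refine iSup_le fun n ↦ ?_
    induction n with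
    | zero => simp
    | succ n ih =>
      rw [pow_succ, Submodule.mul_le]
      exact fun x hx y hy ↦ Subalgebra.mul_mem _ (ih hx) (Algebra.subset_adjoin hy)

/-- Let `A` be a graded `k`-algebra generated in degree 1 and `I` a homogeneous ideal
generated by forms of degree at most `d`.  For a diagonal `Δ = (c,e)` with `c ≥ de + 1`,
the components `C s = (I^{es})_{cs}` satisfy `C s · C t = C (s+t)` for `s,t ≥ 1`, and
consequently the diagonal `⊕ₛ (I^{es})_{cs}` of the Rees algebra coincides with the
`k`-subalgebra `k[(I^e)_c]` of `A` generated by the vector space `(I^e)_c`. -/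
theorem stmt4 {k A : Type*} [Field k] [CommRing A] [Algebra k A]
    (𝒜 : ℕ → Submodule k A) [GradedAlgebra 𝒜]
    (hzero : 𝒜 0 ≤ 1)
    (hstd : ∀ n : ℕ, 𝒜 (n + 1) =
      Submodule.span k (Set.image2 (· * ·) (𝒜 1 : Set A) (𝒜 n : Set A)))
    (I : Ideal A) (d : ℕ) (T : Set A)
    (hspan : I = Ideal.span T) (hT : ∀ f ∈ T, ∃ i ≤ d, f ∈ 𝒜 i)
    (c e : ℕ) (he : 0 < e) (hc : d * e + 1 ≤ c)
    (C : ℕ → Submodule k A)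
    (hC : ∀ s, C s = Submodule.restrictScalars k (I ^ (e * s)) ⊓ 𝒜 (c * s)) :
    (∀ s t : ℕ, 0 < s → 0 < t → C s * C t = C (s + t)) ∧
    Subalgebra.toSubmodule (Algebra.adjoin k (C 1 : Set A)) = ⨆ s : ℕ, C s := by
  subst hspan
  have hmul (s t : ℕ) : C s * C t = C (s + t) := by
    have hdeg (s : ℕ) : d * (e * s) ≤ c * s := by
      rw [← mul_assoc]
      exact Nat.mul_le_mul_right s (by omega)
    simp only [hC, mul_add]
    exact StandardGraded.pow_inf_component_mul 𝒜 hzero hstd hT (hdeg s) (hdeg t)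
  refine ⟨fun s t _ _ ↦ hmul s t, ?_⟩
  have hpow (s : ℕ) : C 1 ^ s = C s := by
    induction s with
    | zero =>
      have h : 𝒜 0 = 1 := le_antisymm hzero (Submodule.one_le.2 SetLike.GradedOne.one_mem)
      rw [pow_zero, hC, mul_zero, mul_zero, pow_zero, h, Ideal.one_eq_top,
        Submodule.restrictScalars_top, top_inf_eq]
    | succ s ih => rw [pow_succ, ih, hmul]
  simp only [toSubmodule_adjoin_eq_iSup_pow, hpow]
end

section
/- Let A be a noetherian commutative domain of finite Krull dimension and I a nonzero ideal of A. Then the Rees algebra A[It] = ⊕_{n≥0} Iⁿtⁿ ⊆ A[t] has Krull dimension dim A[It] = dim A + 1. -/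
open Polynomial

/-- Adjoining an algebraic element to a noetherian domain does not increase the Krull dimension. -/
lemma ringKrullDim_range_aeval_le {R T : Type*} [CommRing R] [IsDomain R]
    [IsNoetherianRing R] [CommRing T] [Algebra R T] {x : T}
    (hx : IsAlgebraic R x) : ringKrullDim (aeval (R := R) x).range ≤ ringKrullDim R := by
  obtain ⟨p, hp, hpx⟩ := hx
  have h := ringKrullDim_succ_le_of_surjective (r := p) (aeval (R := R) x).rangeRestrict.toRingHom
    (aeval (R := R) x).rangeRestrict_surjective (mem_nonZeroDivisors_of_ne_zero hp)
    (Subtype.ext hpx)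
  rw [Polynomial.ringKrullDim_of_isNoetherianRing] at h
  exact ENat.WithBot.add_le_add_one_right_iff.mp h

/-- The algebra generated by degree-one monomials, one of which has nonzero coefficient `a`, has
Krull dimension at most that of the polynomial ring. -/
lemma ringKrullDim_adjoin_monomial_le {A : Type*} [CommRing A] [IsDomain A] [IsNoetherianRing A]
    {a : A} (ha : a ≠ 0) (s : Finset A) :
    ringKrullDim (Algebra.adjoin A (monomial 1 '' (insert a (s : Set A)) : Set A[X])) ≤
      ringKrullDim A + 1 := by
  classical
  induction s using Finset.induction_on with
  | empty =>
    rw [Finset.coe_empty, insert_empty_eq, Set.image_singleton,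
      Algebra.adjoin_singleton_eq_range_aeval]
    refine (ringKrullDim_le_of_surjective
      (aeval (R := A) (monomial 1 a : A[X])).rangeRestrict.toRingHom
      (aeval (R := A) (monomial 1 a : A[X])).rangeRestrict_surjective).trans ?_
    rw [Polynomial.ringKrullDim_of_isNoetherianRing]
  | insert b s _ ih =>
    set B := Algebra.adjoin A (monomial 1 '' (insert a (s : Set A)) : Set A[X]) with hB
    have : IsNoetherianRing B := isNoetherianRing_of_fg <|
      Subalgebra.fg_def.mpr ⟨_, (s.finite_toSet.insert a).image _, rfl⟩
    have hmem : (monomial 1 a : A[X]) ∈ B :=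
      Algebra.subset_adjoin ⟨a, Set.mem_insert _ _, rfl⟩
    have halg : IsAlgebraic B (monomial 1 b : A[X]) := by
      refine ⟨C (algebraMap A B a) * X - C (b • ⟨monomial 1 a, hmem⟩), fun h ↦ ?_, ?_⟩
      · have h1 : algebraMap A B a = 0 := by simpa [coeff_C] using congrArg (coeff · 1) h
        exact ha (by simpa using congrArg Subtype.val h1)
      · rw [map_sub, map_mul, aeval_X, aeval_C, aeval_C]
        change C a * monomial 1 b - b • monomial 1 a = 0
        rw [C_mul_monomial, smul_monomial, smul_eq_mul, mul_comm, sub_self]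
    have h := (ringKrullDim_range_aeval_le halg).trans ih
    have e : Algebra.adjoin A
        (monomial 1 '' (insert a ((insert b s : Finset A) : Set A)) : Set A[X]) =
        (aeval (R := B) (monomial 1 b : A[X])).range.restrictScalars A := by
      rw [← Algebra.adjoin_singleton_eq_range_aeval, hB,
        ← Algebra.adjoin_union_eq_adjoin_adjoin, Finset.coe_insert, Set.insert_comm, Set.image_insert_eq, Set.union_singleton]
    rw [e]
    exact h

/-- For a noetherian domain `A` of finite Krull dimension and a nonzero ideal `I`,
the Rees algebra `A[It] = ⊕ₙ Iⁿtⁿ` has Krull dimension `dim A + 1`. -/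
theorem stmt11 {A : Type*} [CommRing A] [IsDomain A] [IsNoetherianRing A]
    (hfin : ringKrullDim A < ⊤) (I : Ideal A) (hI : I ≠ ⊥) :
    ringKrullDim (reesAlgebra I) = ringKrullDim A + 1 := by
  obtain ⟨a, haI, ha⟩ := Submodule.exists_mem_ne_zero_of_ne_bot hI
  apply le_antisymm
  · obtain ⟨s, hs⟩ := (isNoetherian_def.mp ‹IsNoetherianRing A›) I
    have e : reesAlgebra I =
        Algebra.adjoin A (monomial 1 '' (insert a (s : Set A)) : Set A[X]) := by
      have hs' : Submodule.span A (insert a (s : Set A)) = I := by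
        rw [Submodule.span_insert_eq_span (hs.symm ▸ haI), hs]
      conv_lhs => rw [← adjoin_monomial_eq_reesAlgebra, ← hs', Submodule.map_span,
        Algebra.adjoin_span]
    rw [e]
    exact ringKrullDim_adjoin_monomial_le ha s
  · have hmem : (monomial 1 a : A[X]) ∈ reesAlgebra I :=
      reesAlgebra.monomial_mem.mpr (by simpa using haI)
    refine ringKrullDim_succ_le_of_surjective (r := (⟨monomial 1 a, hmem⟩ : reesAlgebra I))
      ((constantCoeff : A[X] →+* A).comp (reesAlgebra I).val.toRingHom)
      (fun r ↦ ⟨algebraMap A _ r, by simp⟩) (mem_nonZeroDivisors_of_ne_zero fun h ↦ ha ?_) ?_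
    · simpa using congrArg Subtype.val h
    · simp
end

section
/- Let A be a noetherian standard graded algebra over a field k with graded maximal ideal 𝔪 = ⊕_{n≥1} A_n, and let L be a finitely generated graded A-module with d = dim L > 0. Let a(L) = max{ j : H^d_𝔪(L)_j ≠ 0 } be the a-invariant of L. Then H^d_𝔪(L)_j ≠ 0 for every integer j ≤ a(L). -/
universe u v w

section TopLocalCohomology

open CategoryTheory Opposite Limits

section Bridge

lemma ModuleCat.unop_hom_congr {R : Type*} [Ring R] {M N : (ModuleCat.{v} R)ᵒᵖ} {f g : M ⟶ N}
    (h : f = g) (z : N.unop) : f.unop.hom z = g.unop.hom z := by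
  rw [h]

variable {R : Type*} [CommRing R] {C : Type u} [Category.{v} C] [Abelian C] [Linear R C]
  {X : C} (P : ProjectiveResolution X) (Y : C) (n : ℕ)

variable (R) in
/-- The complex `Hom(P, Y)` attached to a projective resolution `P`, as a chain complex in the opposite
category of modules. -/
noncomputable abbrev yonedaComplex : ChainComplex (ModuleCat.{v} R)ᵒᵖ ℕ :=
  (((linearYoneda R C).obj Y).rightOp.mapHomologicalComplex _).obj P.complex

variable (R) in
/-- The module of `n`-cocycles of `Hom(P, Y)`. -/
noncomputable def extCocycles : ModuleCat.{v} R := ((yonedaComplex R P Y).opcycles n).unop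

/-- The inclusion of the `n`-cocycles of `Hom(P, Y)` in `Hom(P.complex.X n, Y)`. -/
noncomputable def extCocyclesι : extCocycles R P Y n →ₗ[R] (P.complex.X n ⟶ Y) :=
  ((yonedaComplex R P Y).pOpcycles n).unop.hom

lemma extCocyclesι_injective : Function.Injective (extCocyclesι (R := R) P Y n) :=
  (ModuleCat.mono_iff_injective ((yonedaComplex R P Y).pOpcycles n).unop).1 inferInstance

lemma d_comp_extCocyclesι (z : extCocycles R P Y n) (m : ℕ) :
    P.complex.d m n ≫ extCocyclesι P Y n z = 0 :=
  ModuleCat.unop_hom_congr ((yonedaComplex R P Y).d_pOpcycles m n) z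

lemma exists_extCocyclesι_eq (f : P.complex.X n ⟶ Y) (hf : P.complex.d (n + 1) n ≫ f = 0) :
    ∃ z : extCocycles R P Y n, extCocyclesι P Y n z = f := by
  have h := (ShortComplex.exact_of_g_is_cokernel
    (ShortComplex.mk _ _ ((yonedaComplex R P Y).d_pOpcycles (n + 1) n))
    ((yonedaComplex R P Y).opcyclesIsCokernel (n + 1) n (by simp))).unop
  rw [ShortComplex.moduleCat_exact_iff] at h
  exact h f hf

section Map

variable {X' : C} {g : X' ⟶ X} {P' : ProjectiveResolution X'}

variable {P}

/-- The map on `n`-cocycles induced by a morphism of projective resolutions. -/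
noncomputable def extCocyclesMap (φ : ProjectiveResolution.Hom P' P g) :
    extCocycles R P Y n →ₗ[R] extCocycles R P' Y n :=
  (HomologicalComplex.opcyclesMap
    ((((linearYoneda R C).obj Y).rightOp.mapHomologicalComplex _).map φ.hom) n).unop.hom

lemma extCocyclesι_map (φ : ProjectiveResolution.Hom P' P g) (z : extCocycles R P Y n) :
    extCocyclesι P' Y n (extCocyclesMap Y n φ z) = φ.hom.f n ≫ extCocyclesι P Y n z :=
  ModuleCat.unop_hom_congr (HomologicalComplex.p_opcyclesMap
    ((((linearYoneda R C).obj Y).rightOp.mapHomologicalComplex _).map φ.hom) n) z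

end Map

section Mk

variable [HasExt.{w} C]

/-- The class of an `n`-cocycle in `Abelian.Ext`. -/
noncomputable def extCocyclesMk : extCocycles R P Y n →ₗ[R] Abelian.Ext.{w} X Y n where
  toFun z := P.extMk (extCocyclesι P Y n z) (n + 1) rfl (d_comp_extCocyclesι P Y n z _)
  map_add' z z' := by
    rw [P.add_extMk]
    simp only [map_add]
  map_smul' r z := by
    rw [RingHom.id_apply, Abelian.Ext.smul_eq_comp_mk₀, P.extMk_comp_mk₀]
    simp only [map_smul, Linear.comp_smul, Category.comp_id]

lemma extCocyclesMk_surjective :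
    Function.Surjective (extCocyclesMk (R := R) P Y n : _ → Abelian.Ext.{w} X Y n) := by
  intro α
  obtain ⟨f, hf, rfl⟩ := P.extMk_surjective α (n + 1) rfl
  obtain ⟨z, rfl⟩ := exists_extCocyclesι_eq (R := R) P Y n f hf
  exact ⟨z, rfl⟩

variable {X' : C} {g : X' ⟶ X} {P' : ProjectiveResolution X'} {P} in
lemma extCocyclesMk_map (φ : ProjectiveResolution.Hom P' P g) (z : extCocycles R P Y n) :
    (extCocyclesMk P' Y n (extCocyclesMap Y n φ z) : Abelian.Ext.{w} X' Y n) =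
      (Abelian.Ext.mk₀ g).comp (extCocyclesMk P Y n z) (zero_add n) := by
  refine Eq.trans ?_ (ProjectiveResolution.mk₀_comp_extMk _ _ rfl
    (d_comp_extCocyclesι P Y n z _) φ).symm
  simp only [extCocyclesMk, LinearMap.coe_mk, AddHom.coe_mk, extCocyclesι_map]

end Mk

variable [EnoughProjectives C]

variable (R) in
/-- The dual of the projection from the `n`-cocycles of `Hom(P, Y)` to their cohomology. -/
noncomputable def leftDerivedToOpcycles :
    (((linearYoneda R C).obj Y).rightOp.leftDerived n).obj X ⟶ (yonedaComplex R P Y).opcycles n :=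
  (P.isoLeftDerivedObj ((linearYoneda R C).obj Y).rightOp n).hom ≫
    (yonedaComplex R P Y).homologyι n

instance : Mono (leftDerivedToOpcycles R P Y n) := by
  delta leftDerivedToOpcycles
  exact mono_comp' inferInstance
    (inferInstanceAs (Mono (HomologicalComplex.homologyι _ n)))

lemma leftDerivedToOpcycles_fromOpcycles (m : ℕ) :
    leftDerivedToOpcycles R P Y n ≫ (yonedaComplex R P Y).fromOpcycles n m = 0 :=
  (Category.assoc _ _ _).trans ((congrArg (_ ≫ ·)
    ((yonedaComplex R P Y).homologyι_comp_fromOpcycles n m)).trans Limits.comp_zero)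

/-- The class of an `n`-cocycle in `Ext`, defined as a derived functor of `Hom(-, Y)`. -/
noncomputable def extCocyclesClass :
    extCocycles R P Y n →ₗ[R] ((Ext R C n).obj (op X)).obj Y :=
  (leftDerivedToOpcycles R P Y n).unop.hom

lemma extCocyclesClass_surjective : Function.Surjective (extCocyclesClass (R := R) P Y n) :=
  (ModuleCat.epi_iff_surjective (leftDerivedToOpcycles R P Y n).unop).1 inferInstance

lemma extCocyclesClass_eq_zero (z : extCocycles R P Y n) (m : ℕ) (g : P.complex.X m ⟶ Y)
    (h : extCocyclesι P Y n z = P.complex.d n m ≫ g) : extCocyclesClass P Y n z = 0 := by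
  have h₁ := ModuleCat.unop_hom_congr ((yonedaComplex R P Y).p_fromOpcycles n m) g
  have h₂ : z = ((yonedaComplex R P Y).fromOpcycles n m).unop.hom g :=
    extCocyclesι_injective P Y n (h.trans h₁.symm)
  rw [h₂]
  exact ModuleCat.unop_hom_congr (leftDerivedToOpcycles_fromOpcycles P Y n m) g

lemma extCocyclesClass_eq_zero_of_mk [HasExt.{w} C] (z : extCocycles R P Y (n + 1))
    (h : (extCocyclesMk P Y (n + 1) z : Abelian.Ext.{w} X Y (n + 1)) = 0) :
    extCocyclesClass P Y (n + 1) z = 0 := by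
  obtain ⟨g, hg⟩ := (P.extMk_eq_zero_iff _ _ rfl (d_comp_extCocyclesι P Y _ z _) n rfl).1 h
  exact extCocyclesClass_eq_zero P Y (n + 1) z n g hg.symm

variable {X' : C} {g : X' ⟶ X} {P' : ProjectiveResolution X'} {P}

lemma leftDerived_map_comp_leftDerivedToOpcycles (φ : ProjectiveResolution.Hom P' P g) :
    (((linearYoneda R C).obj Y).rightOp.leftDerived n).map g ≫ leftDerivedToOpcycles R P Y n =
      leftDerivedToOpcycles R P' Y n ≫ HomologicalComplex.opcyclesMap
        ((((linearYoneda R C).obj Y).rightOp.mapHomologicalComplex _).map φ.hom) n := by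
  have h₁ := ProjectiveResolution.isoLeftDerivedObj_hom_naturality g P' P φ.hom
    (φ.hom_f_zero_comp_π_f_zero.trans (congrArg (_ ≫ ·) (ChainComplex.single₀_map_f_zero g)))
    ((linearYoneda R C).obj Y).rightOp n
  have h₂ := HomologicalComplex.homologyι_naturality
    ((((linearYoneda R C).obj Y).rightOp.mapHomologicalComplex _).map φ.hom) n
  exact (Category.assoc _ _ _).symm.trans ((congrArg (· ≫ _) h₁).trans
    ((Category.assoc _ _ _).trans ((congrArg (_ ≫ ·) h₂).trans (Category.assoc _ _ _).symm)))

lemma extCocyclesClass_map (φ : ProjectiveResolution.Hom P' P g) (z : extCocycles R P Y n) :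
    extCocyclesClass P' Y n (extCocyclesMap Y n φ z) =
      ((Ext R C n).map g.op).app Y (extCocyclesClass P Y n z) :=
  (ModuleCat.unop_hom_congr (leftDerived_map_comp_leftDerivedToOpcycles Y n φ) z).symm

/-- Every class in positive degree of `Ext`, defined as a derived functor, has a counterpart in
`Abelian.Ext` that controls when its pullbacks lie in `I • ⊤`. -/
lemma Ext.exists_abelianExt_forall_map_mem_smul_top [HasExt.{w} C] (I : Ideal R)
    (e : ((Ext R C (n + 1)).obj (op X)).obj Y) :
    ∃ α : Abelian.Ext.{w} X Y (n + 1), ∀ (X' : C) (g : X' ⟶ X),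
      (Abelian.Ext.mk₀ g).comp α (zero_add _) ∈
        I • (⊤ : Submodule R (Abelian.Ext.{w} X' Y (n + 1))) →
      ((Ext R C (n + 1)).map g.op).app Y e ∈
        I • (⊤ : Submodule R (((Ext R C (n + 1)).obj (op X')).obj Y)) := by
  let P := projectiveResolution X
  obtain ⟨z, rfl⟩ := extCocyclesClass_surjective P Y (n + 1) e
  refine ⟨extCocyclesMk P Y (n + 1) z, fun X' g hg ↦ ?_⟩
  let P' := projectiveResolution X'
  let φ : ProjectiveResolution.Hom P' P g := ⟨ProjectiveResolution.lift g P' P,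
    (ProjectiveResolution.lift_commutes_zero g P' P).trans
      (congrArg (_ ≫ ·) (ChainComplex.single₀_map_f_zero g).symm)⟩
  rw [← extCocyclesMk_map Y _ φ, ← LinearMap.range_eq_top.2 (extCocyclesMk_surjective P' Y _),
    LinearMap.range_eq_map, ← Submodule.map_smul''] at hg
  obtain ⟨z', hz', h⟩ := hg
  rw [← extCocyclesClass_map Y _ φ, ← LinearMap.range_eq_top.2 (extCocyclesClass_surjective P' Y _),
    LinearMap.range_eq_map, ← Submodule.map_smul'']
  refine ⟨z', hz', ?_⟩
  rw [← sub_eq_zero, ← map_sub] at h ⊢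
  exact extCocyclesClass_eq_zero_of_mk P' Y n _ h

end Bridge

section PowQuotient

variable {A : Type u} [CommRing A] (I : Ideal A)

/-- The module `A ⧸ I ^ n`. -/
abbrev powQuotient (n : ℕ) : ModuleCat.{u} A := ModuleCat.of A (A ⧸ I ^ n)

/-- The projection `A ⧸ I ^ m ⟶ A ⧸ I ^ n` for `n ≤ m`. -/
def powQuotientMap {n m : ℕ} (h : n ≤ m) : powQuotient I m ⟶ powQuotient I n :=
  ModuleCat.ofHom (Submodule.mapQ _ _ LinearMap.id (Ideal.pow_le_pow_right h))

lemma powQuotientMap_comp {n m l : ℕ} (h : n ≤ m) (h' : m ≤ l) :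
    powQuotientMap I h' ≫ powQuotientMap I h = powQuotientMap I (h.trans h') := by
  ext
  rfl

variable {I}

/-- The transition map `Ext (A ⧸ I ^ n) M i → Ext (A ⧸ I ^ m) M i` for `n ≤ m`. -/
noncomputable def extRes {n m : ℕ} (h : n ≤ m) {M : ModuleCat.{u} A} {i : ℕ} :
    Abelian.Ext (powQuotient I n) M i →ₗ[A] Abelian.Ext (powQuotient I m) M i where
  toFun e := (Abelian.Ext.mk₀ (powQuotientMap I h)).comp e (zero_add i)
  map_add' e e' := by simp
  map_smul' r e := by simp

lemma extRes_apply {n m : ℕ} (h : n ≤ m) {M : ModuleCat.{u} A} {i : ℕ}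
    (e : Abelian.Ext (powQuotient I n) M i) :
    extRes h e = (Abelian.Ext.mk₀ (powQuotientMap I h)).comp e (zero_add i) := rfl

lemma extRes_extRes {n m l : ℕ} (h : n ≤ m) (h' : m ≤ l) {M : ModuleCat.{u} A} {i : ℕ}
    (e : Abelian.Ext (powQuotient I n) M i) :
    extRes h' (extRes h e) = extRes (h.trans h') e := by
  simp [extRes_apply, powQuotientMap_comp]

lemma extRes_comp {n m : ℕ} (h : n ≤ m) {M N : ModuleCat.{u} A} {i j l : ℕ}
    (e : Abelian.Ext (powQuotient I n) M i) (f : Abelian.Ext M N j) (hl : i + j = l) :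
    extRes h (e.comp f hl) = (extRes h e).comp f hl := by
  simp only [extRes_apply]
  exact (Abelian.Ext.comp_assoc _ _ _ _ _ (by lia)).symm

lemma Abelian.Ext.comp_mk₀_mem_smul_top {X M N : ModuleCat.{u} A} {i : ℕ} (J : Ideal A)
    (e : Abelian.Ext X M i) (g : M ⟶ N) (he : e ∈ J • (⊤ : Submodule A (Abelian.Ext X M i))) :
    e.comp (Abelian.Ext.mk₀ g) (add_zero i) ∈ J • (⊤ : Submodule A (Abelian.Ext X N i)) := by
  induction he using Submodule.smul_induction_on' with
  | smul r hr n hn =>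
    rw [Abelian.Ext.smul_comp]
    exact Submodule.smul_mem_smul hr trivial
  | add x _ y _ hx hy =>
    rw [Abelian.Ext.add_comp]
    exact add_mem hx hy

lemma extRes_mem_smul_top {n m : ℕ} (h : n ≤ m) {M : ModuleCat.{u} A} {i : ℕ} (J : Ideal A)
    {e : Abelian.Ext (powQuotient I n) M i}
    (he : e ∈ J • (⊤ : Submodule A (Abelian.Ext (powQuotient I n) M i))) :
    extRes h e ∈ J • (⊤ : Submodule A (Abelian.Ext (powQuotient I m) M i)) := by
  have := Submodule.mem_map_of_mem (f := extRes h) he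
  rw [Submodule.map_smul''] at this
  exact Submodule.smul_mono le_rfl le_top this

lemma smul_ext_powQuotient_eq_zero {n : ℕ} {M : ModuleCat.{u} A} {i : ℕ} {r : A} (hr : r ∈ I ^ n)
    (e : Abelian.Ext (powQuotient I n) M i) : r • e = 0 := by
  have h : r • 𝟙 (powQuotient I n) = 0 := by
    ext
    change r • (Ideal.Quotient.mk (I ^ n) 1) = 0
    rw [← Ideal.Quotient.mkₐ_eq_mk A, ← map_smul, Ideal.Quotient.mkₐ_eq_mk,
      Ideal.Quotient.eq_zero_iff_mem]
    simpa using hr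
  rw [← Abelian.Ext.mk₀_id_comp e, ← Abelian.Ext.smul_comp, ← Abelian.Ext.mk₀_smul, h]
  simp

variable (I)

/-- The direct system `Ext (A ⧸ I ^ n) M i` is essentially zero, that is, its colimit (the `i`-th
local cohomology of `M`) vanishes. -/
def ExtEssZero (i : ℕ) (M : ModuleCat.{u} A) : Prop :=
  ∀ (n : ℕ) (e : Abelian.Ext (powQuotient I n) M i), ∃ (m : ℕ) (h : n ≤ m), extRes h e = 0

/-- The colimit `H` of the direct system `Ext (A ⧸ I ^ n) M i` satisfies `I • H = H`. -/
def ExtEssSMulTop (i : ℕ) (M : ModuleCat.{u} A) : Prop :=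
  ∀ (n : ℕ) (e : Abelian.Ext (powQuotient I n) M i), ∃ (m : ℕ) (h : n ≤ m),
    extRes h e ∈ I • (⊤ : Submodule A (Abelian.Ext (powQuotient I m) M i))

variable {I}

lemma ExtEssZero.extEssSMulTop {i : ℕ} {M : ModuleCat.{u} A} (h : ExtEssZero I i M) :
    ExtEssSMulTop I i M := fun n e ↦ by
  obtain ⟨m, hm, he⟩ := h n e
  exact ⟨m, hm, he ▸ zero_mem _⟩

lemma ExtEssZero.of_subsingleton {i : ℕ} {M : ModuleCat.{u} A} [Subsingleton M] :
    ExtEssZero I i M := fun n e ↦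
  ⟨n, le_rfl, by
    have h : 𝟙 M = 0 := (ModuleCat.isZero_of_subsingleton M).eq_of_src _ _
    rw [← Abelian.Ext.comp_mk₀_id e, h]
    simp⟩

lemma ExtEssZero.of_shortExact {S : ShortComplex (ModuleCat.{u} A)} (hS : S.ShortExact) {i : ℕ}
    (h₁ : ExtEssZero I i S.X₁) (h₃ : ExtEssZero I i S.X₃) : ExtEssZero I i S.X₂ := fun n e ↦ by
  obtain ⟨m, hm, he⟩ := h₃ n (e.comp (Abelian.Ext.mk₀ S.g) (add_zero i))
  rw [extRes_comp] at he
  obtain ⟨e₁, he₁⟩ := Abelian.Ext.covariant_sequence_exact₂ _ hS _ he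
  obtain ⟨l, hl, he₁'⟩ := h₁ m e₁
  refine ⟨l, hm.trans hl, ?_⟩
  rw [← extRes_extRes hm hl, ← he₁, extRes_comp, he₁', Abelian.Ext.zero_comp]

lemma ExtEssZero.exists_lift_mem_smul_top {S : ShortComplex (ModuleCat.{u} A)}
    (hS : S.ShortExact) {i : ℕ} (h₁ : ExtEssZero I (i + 1) S.X₁) {n : ℕ}
    {e : Abelian.Ext (powQuotient I n) S.X₃ i}
    (he : e ∈ I • (⊤ : Submodule A (Abelian.Ext (powQuotient I n) S.X₃ i))) :
    ∃ (m : ℕ) (h : n ≤ m), ∃ f ∈ I • (⊤ : Submodule A (Abelian.Ext (powQuotient I m) S.X₂ i)),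
      f.comp (Abelian.Ext.mk₀ S.g) (add_zero i) = extRes h e := by
  induction he using Submodule.smul_induction_on' with
  | smul r hr e _ =>
    obtain ⟨m, hm, he⟩ := h₁ n (e.comp hS.extClass rfl)
    rw [extRes_comp] at he
    obtain ⟨f, hf⟩ := Abelian.Ext.covariant_sequence_exact₃ _ hS _ rfl he
    refine ⟨m, hm, r • f, Submodule.smul_mem_smul hr trivial, ?_⟩
    rw [Abelian.Ext.smul_comp, hf, map_smul]
  | add x _ y _ hx hy =>
    obtain ⟨m, hm, f, hf, hfx⟩ := hx
    obtain ⟨l, hl, g, hg, hgy⟩ := hy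
    refine ⟨max m l, hm.trans (le_max_left m l),
      extRes (le_max_left m l) f + extRes (le_max_right m l) g,
      add_mem (extRes_mem_smul_top _ I hf) (extRes_mem_smul_top _ I hg), ?_⟩
    rw [Abelian.Ext.add_comp, ← extRes_comp, ← extRes_comp, hfx, hgy, extRes_extRes,
      extRes_extRes, map_add]

lemma ExtEssSMulTop.of_shortExact {S : ShortComplex (ModuleCat.{u} A)} (hS : S.ShortExact) {i : ℕ}
    (h : ExtEssZero I (i + 1) S.X₁) (h₁ : ExtEssSMulTop I i S.X₁) (h₃ : ExtEssSMulTop I i S.X₃) :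
    ExtEssSMulTop I i S.X₂ := fun n e ↦ by
  obtain ⟨m, hm, he⟩ := h₃ n (e.comp (Abelian.Ext.mk₀ S.g) (add_zero i))
  obtain ⟨l, hl, f, hf, hfe⟩ := h.exists_lift_mem_smul_top hS he
  rw [extRes_extRes, extRes_comp, ← sub_eq_zero, sub_eq_add_neg, ← Abelian.Ext.neg_comp,
    ← Abelian.Ext.add_comp] at hfe
  obtain ⟨e₁, he₁⟩ := Abelian.Ext.covariant_sequence_exact₂ _ hS _ hfe
  obtain ⟨l', hl', he₁'⟩ := h₁ l e₁
  refine ⟨l', (hm.trans hl).trans hl', ?_⟩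
  have h' := Abelian.Ext.comp_mk₀_mem_smul_top I _ S.f he₁'
  rw [← extRes_comp, he₁, map_add, map_neg, extRes_extRes] at h'
  have := sub_mem (extRes_mem_smul_top hl' I hf) h'
  simpa using this

section Regular

variable {M N : ModuleCat.{u} A} {x : A} {g : M ⟶ N} {w : (x • 𝟙 M) ≫ g = 0}

lemma ExtEssZero.of_regular (hS : (ShortComplex.mk (x • 𝟙 M) g w).ShortExact) (hx : x ∈ I) {i : ℕ}
    (h : ExtEssZero I i N) : ExtEssZero I (i + 1) M := by
  have key (k : ℕ) : ∀ (n : ℕ) (e : Abelian.Ext (powQuotient I n) M (i + 1)), x ^ k • e = 0 →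
      ∃ (m : ℕ) (h : n ≤ m), extRes h e = 0 := by
    induction k with
    | zero => exact fun n e he ↦ ⟨n, le_rfl, by simp_all⟩
    | succ k ih =>
      intro n e he
      rw [pow_succ', mul_smul, Abelian.Ext.smul_eq_comp_mk₀] at he
      obtain ⟨f, hf⟩ := Abelian.Ext.covariant_sequence_exact₁ _ hS _ he rfl
      obtain ⟨m, hm, hfm⟩ := h n f
      obtain ⟨l, hl, hel⟩ := ih m (extRes hm e) (by
        rw [← map_smul, ← hf, extRes_comp, hfm, Abelian.Ext.zero_comp])
      exact ⟨l, hm.trans hl, by rw [← extRes_extRes hm hl, hel]⟩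
  exact fun n e ↦ key n n e (smul_ext_powQuotient_eq_zero (Ideal.pow_mem_pow hx n) e)

lemma ExtEssSMulTop.of_regular (hS : (ShortComplex.mk (x • 𝟙 M) g w).ShortExact) (hx : x ∈ I)
    {i : ℕ} (h : ExtEssZero I i N) : ExtEssSMulTop I i M := fun n e ↦ by
  obtain ⟨m, hm, he⟩ := h n (e.comp (Abelian.Ext.mk₀ g) (add_zero i))
  rw [extRes_comp] at he
  obtain ⟨f, hf⟩ := Abelian.Ext.covariant_sequence_exact₂ _ hS _ he
  refine ⟨m, hm, ?_⟩
  rw [← hf]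
  refine Set.mem_of_eq_of_mem (Abelian.Ext.smul_eq_comp_mk₀ f x).symm ?_
  exact Submodule.smul_mem_smul hx trivial

end Regular

end PowQuotient

section Torsion

lemma Abelian.Ext.exists_forall_comp_eq_zero {C : Type*} [Category* C] [Abelian C] [HasExt.{w} C]
    {S : ShortComplex C} (hS : S.ShortExact) [Projective S.X₂] {M : C} {i : ℕ}
    (α : Abelian.Ext.{w} S.X₃ M (i + 1)) :
    ∃ β : Abelian.Ext.{w} S.X₁ M i, ∀ {T : ShortComplex C} (_ : T.ShortExact) (φ : T ⟶ S),
      (Abelian.Ext.mk₀ φ.τ₁).comp β (zero_add i) = 0 →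
        (Abelian.Ext.mk₀ φ.τ₃).comp α (zero_add (i + 1)) = 0 := by
  obtain ⟨β, rfl⟩ := Abelian.Ext.contravariant_sequence_exact₃ hS M α
    (Abelian.Ext.eq_zero_of_projective _) (add_comm 1 i)
  refine ⟨β, fun hT φ h ↦ ?_⟩
  rw [← Abelian.Ext.comp_assoc _ _ _ (zero_add 1) _ (by lia),
    ← ShortComplex.ShortExact.extClass_naturality hT hS φ,
    Abelian.Ext.comp_assoc_of_second_deg_zero, h, Abelian.Ext.comp_zero]

variable {A : Type u} [CommRing A] {I : Ideal A}

lemma Abelian.Ext.mk₀_comp_comp_eq_zero {C : Type*} [Category* C] [Abelian C] [HasExt.{w} C]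
    {X Y Z M : C} {i : ℕ} (f : X ⟶ Y) {g : Y ⟶ Z} {α : Abelian.Ext.{w} Z M i}
    (h : (Abelian.Ext.mk₀ g).comp α (zero_add i) = 0) :
    (Abelian.Ext.mk₀ (f ≫ g)).comp α (zero_add i) = 0 := by
  rw [← Abelian.Ext.mk₀_comp_mk₀, Abelian.Ext.comp_assoc_of_second_deg_zero, h,
    Abelian.Ext.comp_zero]

lemma ModuleCat.shortExact_of_function_exact {N₁ N₂ N₃ : Type u} [AddCommGroup N₁] [Module A N₁]
    [AddCommGroup N₂] [Module A N₂] [AddCommGroup N₃] [Module A N₃] {f : N₁ →ₗ[A] N₂}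
    {g : N₂ →ₗ[A] N₃} (hf : Function.Injective f) (hg : Function.Surjective g)
    (h : Function.Exact f g) :
    (ShortComplex.mk (ModuleCat.ofHom f) (ModuleCat.ofHom g)
      (ModuleCat.hom_ext h.linearMap_comp_eq_zero)).ShortExact where
  exact := (ShortComplex.ShortExact.moduleCat_exact_iff_function_exact _).2 h
  mono_f := (ModuleCat.mono_iff_injective _).2 hf
  epi_g := (ModuleCat.epi_iff_surjective _).2 hg

variable [IsNoetherianRing A]

/-- A class in `Ext N M i`, with `M` killed by `I`, vanishes on `I ^ m • N` for `m` large; the proof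
is by dimension shifting and the Artin-Rees lemma. -/
lemma exists_pow_smul_comp_eq_zero {M : ModuleCat.{u} A} (hM : I ≤ Module.annihilator A M) (i : ℕ) :
    ∀ (N : Type u) [AddCommGroup N] [Module A N] [Module.Finite A N]
      (α : Abelian.Ext (ModuleCat.of A N) M i), ∃ m : ℕ,
      (Abelian.Ext.mk₀ (ModuleCat.ofHom (I ^ m • (⊤ : Submodule A N)).subtype)).comp α
        (zero_add i) = 0 := by
  induction i with
  | zero =>
    intro N _ _ _ α
    obtain ⟨φ, rfl⟩ := (Abelian.Ext.mk₀_bijective _ _).2 α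
    refine ⟨1, ?_⟩
    rw [Abelian.Ext.mk₀_comp_mk₀]
    refine (congrArg Abelian.Ext.mk₀ ?_).trans (Abelian.Ext.mk₀_zero _ _)
    ext ⟨x, hx⟩
    change φ.hom x = 0
    rw [pow_one] at hx
    induction hx using Submodule.smul_induction_on' with
    | smul r hr n hn =>
      rw [map_smul]
      exact Module.mem_annihilator.1 (hM hr) _
    | add x _ y _ hx hy => rw [map_add, hx, hy, add_zero]
  | succ i ih =>
    intro N _ _ _ α
    obtain ⟨r, π, hπ⟩ := Module.Finite.exists_fin' A N
    have hS := LinearMap.shortExact_shortComplexKer hπ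
    have : Projective (ModuleCat.of A (Fin r → A)) := inferInstance
    obtain ⟨β, hβ⟩ := Abelian.Ext.exists_forall_comp_eq_zero hS α
    obtain ⟨m, hm⟩ := ih (LinearMap.ker π) β
    obtain ⟨k, hk⟩ := I.exists_pow_inf_eq_pow_smul (LinearMap.ker π)
    have hle : I ^ (m + k) • ⊤ ⊓ LinearMap.ker π ≤
        (I ^ m • ⊤ : Submodule A (LinearMap.ker π)).map (LinearMap.ker π).subtype := by
      rw [hk (m + k) (Nat.le_add_left k m), Nat.add_sub_cancel, Submodule.map_smul'']
      exact Submodule.smul_mono le_rfl (by simp)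
    have hmap : (I ^ (m + k) • ⊤ : Submodule A (Fin r → A)).map π = I ^ (m + k) • ⊤ := by
      rw [Submodule.map_smul'', Submodule.map_top, LinearMap.range_eq_top.2 hπ]
    refine ⟨m + k, ?_⟩
    let g : (I ^ (m + k) • ⊤ : Submodule A (Fin r → A)) →ₗ[A] (I ^ (m + k) • ⊤ : Submodule A N) :=
      π.restrict fun x hx ↦ hmap ▸ Submodule.mem_map_of_mem hx
    have hg : Function.Surjective g := fun ⟨y, hy⟩ ↦ by
      obtain ⟨x, hx, rfl⟩ := hmap ▸ hy
      exact ⟨⟨x, hx⟩, rfl⟩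
    have hT := LinearMap.shortExact_shortComplexKer hg
    let ρ₀ : LinearMap.ker g →ₗ[A] LinearMap.ker π := LinearMap.codRestrict _
      (Submodule.subtype _ ∘ₗ Submodule.subtype _) fun x ↦ congrArg Subtype.val x.2
    let ρ : LinearMap.ker g →ₗ[A] (I ^ m • ⊤ : Submodule A (LinearMap.ker π)) :=
      ρ₀.codRestrict _ fun x ↦ by
        obtain ⟨y, hy, hyx⟩ := hle ⟨x.1.2, congrArg Subtype.val x.2⟩
        exact (show y = ρ₀ x from Subtype.ext hyx) ▸ hy
    refine hβ hT { τ₁ := ModuleCat.ofHom ρ ≫ ModuleCat.ofHom (Submodule.subtype _)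
                   τ₂ := ModuleCat.ofHom (Submodule.subtype _)
                   τ₃ := ModuleCat.ofHom (Submodule.subtype _)
                   comm₁₂ := rfl
                   comm₂₃ := rfl } (Abelian.Ext.mk₀_comp_comp_eq_zero _ hm)

lemma ExtEssZero.of_le_annihilator {M : ModuleCat.{u} A} (hM : I ≤ Module.annihilator A M) (i : ℕ) :
    ExtEssZero I (i + 1) M := fun n e ↦ by
  have hS := ModuleCat.shortExact_of_function_exact (I ^ n).injective_subtype
    (I ^ n).mkQ_surjective (LinearMap.exact_subtype_mkQ _)
  have : Projective (ModuleCat.of A A) := inferInstance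
  obtain ⟨β, hβ⟩ := Abelian.Ext.exists_forall_comp_eq_zero hS e
  obtain ⟨m, hm⟩ := exists_pow_smul_comp_eq_zero hM i _ β
  have hT := ModuleCat.shortExact_of_function_exact (I ^ (m + n)).injective_subtype
    (I ^ (m + n)).mkQ_surjective (LinearMap.exact_subtype_mkQ _)
  refine ⟨m + n, Nat.le_add_left n m, ?_⟩
  let ρ : ↥(I ^ (m + n)) →ₗ[A] (I ^ m • ⊤ : Submodule A ↥(I ^ n)) :=
    LinearMap.codRestrict _ (Submodule.inclusion (Ideal.pow_le_pow_right (Nat.le_add_left n m)))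
      fun x ↦ by
        have hx : x.1 ∈ (I ^ m • ⊤ : Submodule A ↥(I ^ n)).map (I ^ n).subtype := by
          rw [Submodule.map_smul'', Submodule.map_top, Submodule.range_subtype, smul_eq_mul,
            ← pow_add]
          exact x.2
        obtain ⟨y, hy, hyx⟩ := hx
        rwa [show y = Submodule.inclusion _ x from Subtype.ext hyx] at hy
  refine hβ hT { τ₁ := ModuleCat.ofHom ρ ≫ ModuleCat.ofHom (Submodule.subtype _)
                 τ₂ := 𝟙 _
                 τ₃ := powQuotientMap I (Nat.le_add_left n m)
                 comm₁₂ := rfl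
                 comm₂₃ := rfl } (Abelian.Ext.mk₀_comp_comp_eq_zero _ hm)

end Torsion

section Vanishing

variable {A : Type u} [CommRing A] {I : Ideal A}

lemma ringKrullDim_quotient_le_of_le {J K : Ideal A} (h : J ≤ K) :
    ringKrullDim (A ⧸ K) ≤ ringKrullDim (A ⧸ J) :=
  ringKrullDim_le_of_surjective (Ideal.Quotient.factor h) (Ideal.Quotient.factor_surjective h)

lemma exists_shortExact_smul {N : Type u} [AddCommGroup N] [Module A N] [Module.Finite A N]
    {p : Ideal A} [p.IsPrime] (f : N ≃ₗ[A] A ⧸ p) {x : A} (hx : x ∉ p) :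
    ∃ (N' : Type u) (_ : AddCommGroup N') (_ : Module A N') (_ : Module.Finite A N')
      (g : ModuleCat.of A N ⟶ ModuleCat.of A N') (w : (x • 𝟙 (ModuleCat.of A N)) ≫ g = 0),
      (ShortComplex.mk (x • 𝟙 (ModuleCat.of A N)) g w).ShortExact ∧
      ringKrullDim (A ⧸ Module.annihilator A N') + 1 ≤
        ringKrullDim (A ⧸ Module.annihilator A N) := by
  have hinj : Function.Injective (x • LinearMap.id : N →ₗ[A] N) := by
    rw [← LinearMap.ker_eq_bot, LinearMap.ker_eq_bot']
    intro y hy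
    have hy' : x • f y = 0 := by simpa using congrArg f hy
    obtain ⟨a, ha⟩ := Ideal.Quotient.mk_surjective (f y)
    rw [← ha, ← Ideal.Quotient.mkₐ_eq_mk A, ← map_smul, Ideal.Quotient.mkₐ_eq_mk,
      Ideal.Quotient.eq_zero_iff_mem, smul_eq_mul] at hy'
    have ha' := (Ideal.IsPrime.mem_or_mem ‹_› hy').resolve_left hx
    rw [Ideal.Quotient.eq_zero_iff_mem.2 ha'] at ha
    simpa using ha.symm
  have hann : Module.annihilator A N = p := by
    rw [f.annihilator_eq, Ideal.annihilator_quotient]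
  let R := LinearMap.range (x • LinearMap.id : N →ₗ[A] N)
  have hle : Module.annihilator A N ≤ Module.annihilator A (N ⧸ R) :=
    R.mkQ.annihilator_le_of_surjective R.mkQ_surjective
  refine ⟨N ⧸ R, inferInstance, inferInstance, inferInstance, ModuleCat.ofHom R.mkQ, _,
    ModuleCat.shortExact_of_function_exact hinj R.mkQ_surjective
      (LinearMap.exact_map_mkQ_range _), ?_⟩
  have : (Module.annihilator A N).IsPrime := hann ▸ ‹p.IsPrime›
  refine ringKrullDim_succ_le_of_surjective (Ideal.Quotient.factor hle)
    (Ideal.Quotient.factor_surjective hle) (r := Ideal.Quotient.mk _ x) ?_ ?_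
  · rw [mem_nonZeroDivisors_iff_ne_zero, Ne, Ideal.Quotient.eq_zero_iff_mem, hann]
    exact hx
  · rw [Ideal.Quotient.factor_mk, Ideal.Quotient.eq_zero_iff_mem, Module.mem_annihilator]
    intro y
    obtain ⟨y, rfl⟩ := R.mkQ_surjective y
    rw [← map_smul]
    exact (Submodule.Quotient.mk_eq_zero _).2 ⟨y, rfl⟩

variable [IsNoetherianRing A]

/-- Local cohomology vanishes above the dimension of the module. -/
theorem ExtEssZero.of_ringKrullDim_lt (i : ℕ) : ∀ (M : Type u) [AddCommGroup M] [Module A M]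
    [Module.Finite A M], ringKrullDim (A ⧸ Module.annihilator A M) < (i : WithBot ℕ∞) →
      ExtEssZero I i (ModuleCat.of A M) := by
  induction i with
  | zero =>
    intro M _ _ _ h
    have : Subsingleton M := by
      rw [← Module.annihilator_eq_top_iff (R := A), ← Ideal.Quotient.subsingleton_iff]
      by_contra hA
      rw [not_subsingleton_iff_nontrivial] at hA
      exact h.not_ge ringKrullDim_nonneg_of_nontrivial
    exact .of_subsingleton
  | succ i ih =>
    intro M _ _ hM
    induction hM using IsNoetherianRing.induction_on_isQuotientEquivQuotientPrime A with
    | subsingleton N => exact fun _ ↦ .of_subsingleton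
    | quotient N p f =>
      intro h
      by_cases hp : I ≤ p.1
      · refine .of_le_annihilator ?_ i
        change I ≤ Module.annihilator A N
        rwa [f.annihilator_eq, Ideal.annihilator_quotient]
      · obtain ⟨x, hx, hxp⟩ := SetLike.not_le_iff_exists.1 hp
        obtain ⟨N', _, _, _, g, w, hS, hdim⟩ := exists_shortExact_smul f hxp
        refine .of_regular hS hx (ih N' (lt_of_add_lt_add_right (a := 1) ?_))
        exact_mod_cast hdim.trans_lt h
    | exact N₁ N₂ N₃ f g hf hg hfg h₁ h₃ =>
      intro h
      exact .of_shortExact (ModuleCat.shortExact_of_function_exact hf hg hfg)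
        (h₁ ((ringKrullDim_quotient_le_of_le (f.annihilator_le_of_injective hf)).trans_lt h))
        (h₃ ((ringKrullDim_quotient_le_of_le (g.annihilator_le_of_surjective hg)).trans_lt h))

/-- In positive degrees that are at least the dimension of the module, the local cohomology `H` with
support in `I` satisfies `I • H = H`. -/
theorem ExtEssSMulTop.of_ringKrullDim_le (i : ℕ) (M : Type u) [AddCommGroup M] [Module A M]
    [hM : Module.Finite A M]
    (h : ringKrullDim (A ⧸ Module.annihilator A M) ≤ ((i + 1 : ℕ) : WithBot ℕ∞)) :
    ExtEssSMulTop I (i + 1) (ModuleCat.of A M) := by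
  induction hM using IsNoetherianRing.induction_on_isQuotientEquivQuotientPrime A with
  | subsingleton N => exact ExtEssZero.of_subsingleton.extEssSMulTop
  | quotient N p f =>
    by_cases hp : I ≤ p.1
    · refine (ExtEssZero.of_le_annihilator ?_ i).extEssSMulTop
      change I ≤ Module.annihilator A N
      rwa [f.annihilator_eq, Ideal.annihilator_quotient]
    · obtain ⟨x, hx, hxp⟩ := SetLike.not_le_iff_exists.1 hp
      obtain ⟨N', _, _, _, g, w, hS, hdim⟩ := exists_shortExact_smul f hxp
      refine .of_regular hS hx (.of_ringKrullDim_lt _ _ (lt_of_add_lt_add_right (a := 1) ?_))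
      refine (hdim.trans h).trans_lt ?_
      exact_mod_cast (i + 1).lt_succ_self
  | exact N₁ N₂ N₃ f g hf hg hfg h₁ h₃ =>
    have h' := (ringKrullDim_quotient_le_of_le (f.annihilator_le_of_injective hf)).trans h
    refine .of_shortExact (ModuleCat.shortExact_of_function_exact hf hg hfg)
      (.of_ringKrullDim_lt _ _ (h'.trans_lt ?_)) (h₁ h')
      (h₃ ((ringKrullDim_quotient_le_of_le (g.annihilator_le_of_surjective hg)).trans h))
    exact_mod_cast (i + 1).lt_succ_self

end Vanishing

section LocalCohomology

variable {A : Type u} [CommRing A] {I : Ideal A}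

lemma localCohomology.exists_rep (i : ℕ) (M : ModuleCat.{u} A)
    (x : (localCohomology I i).obj M) :
    ∃ (n : ℕ) (e : ((Ext A (ModuleCat.{u} A) i).obj (op (powQuotient I n))).obj M)
      (ι : ∀ m : ℕ, ((Ext A (ModuleCat.{u} A) i).obj (op (powQuotient I m))).obj M ⟶
        (localCohomology I i).obj M), ∀ (m : ℕ) (h : n ≤ m),
        ι m (((Ext A (ModuleCat.{u} A) i).map (powQuotientMap I h).op).app M e) = x := by
  have := localCohomology.hasColimitDiagram.{u, 0} (localCohomology.idealPowersDiagram I) i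
  let c := colimit.cocone (localCohomology.diagram (localCohomology.idealPowersDiagram I) i)
  have hc := isColimitOfPreserves ((evaluation _ _).obj M)
    (colimit.isColimit (localCohomology.diagram (localCohomology.idealPowersDiagram I) i))
  have : PreservesFilteredColimitsOfSize.{0, 0} (forget (ModuleCat.{u} A)) :=
    preservesSmallestFilteredColimits_of_preservesFilteredColimits.{u, u} _
  obtain ⟨n, e, he⟩ := Concrete.isColimit_exists_rep _ hc x
  refine ⟨n.unop.unop, e, fun m ↦ (c.ι.app (op (op m))).app M, fun m h ↦ ?_⟩
  rw [← he]
  let φ : n ⟶ op (op m) := (homOfLE h).op.op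
  have := congrArg (fun f ↦ f.app M e) (c.w φ)
  exact this

theorem localCohomology.smul_top_eq_top [IsNoetherianRing A] (i : ℕ) (M : Type u) [AddCommGroup M]
    [Module A M] [Module.Finite A M]
    (h : ringKrullDim (A ⧸ Module.annihilator A M) ≤ ((i + 1 : ℕ) : WithBot ℕ∞)) :
    I • (⊤ : Submodule A ((localCohomology I (i + 1)).obj (ModuleCat.of A M))) = ⊤ := by
  refine eq_top_iff.2 fun x _ ↦ ?_
  obtain ⟨n, e, ι, hι⟩ := localCohomology.exists_rep (i + 1) (ModuleCat.of A M) x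
  obtain ⟨α, hα⟩ := Ext.exists_abelianExt_forall_map_mem_smul_top _ i I e
  obtain ⟨m, hm, hαm⟩ := ExtEssSMulTop.of_ringKrullDim_le (I := I) i M h n α
  have := Submodule.mem_map_of_mem (f := (ι m).hom) (hα _ _ hαm)
  rw [Submodule.map_smul''] at this
  rw [← hι m hm]
  exact Submodule.smul_mono le_rfl le_top this

end LocalCohomology

section Graded

/-- If `H = 𝔪 • H` for the irrelevant ideal `𝔪` of a standard graded algebra, then a zero graded piece
of `H` is followed by a zero graded piece. -/
theorem DirectSum.Decomposition.eq_bot_of_smul_top_eq_top {k A H : Type*} [CommRing k] [CommRing A]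
    [Algebra k A] (𝒜 : ℕ → Submodule k A)
    (hstd : ∀ m : ℕ, 𝒜 (m + 1) =
      Submodule.span k (Set.image2 (· * ·) (𝒜 1 : Set A) (𝒜 m : Set A)))
    [AddCommGroup H] [Module A H] (ℋ : ℤ → AddSubgroup H) [DirectSum.Decomposition ℋ]
    (hsmul : ∀ (m : ℕ) (j : ℤ), ∀ a ∈ 𝒜 m, ∀ x ∈ ℋ j, a • x ∈ ℋ ((m : ℤ) + j))
    (hH : Ideal.span (⋃ (m : ℕ) (_ : 1 ≤ m), (𝒜 m : Set A)) • (⊤ : Submodule A H) = ⊤)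
    {j : ℤ} (hj : ℋ j = ⊥) : ℋ (j + 1) = ⊥ := by
  have key (m : ℕ) : ∀ a ∈ 𝒜 (m + 1), ∀ x ∈ ℋ (j - m), a • x = 0 := by
    intro a ha x hx
    rw [hstd] at ha
    induction ha using Submodule.span_induction with
    | mem a ha =>
      obtain ⟨b, hb, c, hc, rfl⟩ := ha
      have hcx := hsmul m _ c hc x hx
      rw [add_sub_cancel, hj, AddSubgroup.mem_bot] at hcx
      rw [mul_smul, hcx, smul_zero]
    | zero => simp
    | add a b _ _ ha hb => rw [add_smul, ha, hb, add_zero]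
    | smul t a _ ha => rw [Algebra.smul_def, mul_smul, ha, smul_zero]
  have hcomp (x : H) : (DirectSum.decompose ℋ x (j + 1) : H) = 0 := by
    have hx : x ∈ Ideal.span (⋃ (m : ℕ) (_ : 1 ≤ m), (𝒜 m : Set A)) • (⊤ : Submodule A H) :=
      by rw [hH]; trivial
    induction hx using Submodule.smul_induction_on' with
    | add x _ y _ hx hy => simp [hx, hy]
    | smul a ha x _ =>
      induction ha using Submodule.span_induction generalizing x with
      | zero => simp
      | add a b _ _ ha hb => simp [add_smul, ha, hb]
      | smul t a _ ha =>
        rw [smul_eq_mul, mul_comm, mul_smul]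
        exact ha (t • x) trivial
      | mem a ha =>
        simp only [Set.mem_iUnion] at ha
        obtain ⟨m, hm, ha⟩ := ha
        obtain ⟨m, rfl⟩ := Nat.exists_eq_add_of_le' hm
        induction x using DirectSum.Decomposition.inductionOn ℋ with
        | zero => simp
        | add x y hx hy => rw [smul_add, DirectSum.decompose_add, DirectSum.add_apply,
            AddSubgroup.coe_add, hx trivial, hy trivial, add_zero]
        | @homogeneous i x =>
          have hax := hsmul _ _ a ha x x.2
          by_cases hi : i = j - m
          · subst hi
            simp [key m a ha x x.2]
          · exact DirectSum.decompose_of_mem_ne ℋ hax (by push_cast; lia)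
  refine (AddSubgroup.eq_bot_iff_forall _).2 fun x hx ↦ ?_
  rw [← DirectSum.decompose_of_mem_same ℋ hx, hcomp]

end Graded

end TopLocalCohomology

/-- Let `A` be a noetherian standard graded algebra over a field `k` with graded maximal
ideal `𝔪 = ⊕_{m≥1} A_m`, and let `L` be a finitely generated graded `A`-module of
dimension `d = dim L > 0` (the Krull dimension of `A/ann L`).  The top local cohomology
module `H^d_𝔪(L)`, with its natural ℤ-grading `ℋ` (compatible with the grading of `A`),
satisfies `H^d_𝔪(L)_j ≠ 0` for every `j ≤ a(L)`, where `a(L) = max{j : H^d_𝔪(L)_j ≠ 0}`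
is the a-invariant of `L`. -/
theorem stmt15 {k : Type*} {A : Type u} [Field k] [CommRing A] [Algebra k A]
    [IsNoetherianRing A]
    (𝒜 : ℕ → Submodule k A) [GradedAlgebra 𝒜]
    (hzero : 𝒜 0 ≤ 1)
    (hstd : ∀ m : ℕ, 𝒜 (m + 1) =
      Submodule.span k (Set.image2 (· * ·) (𝒜 1 : Set A) (𝒜 m : Set A)))
    (𝔪 : Ideal A)
    (h𝔪 : 𝔪 = Ideal.span (⋃ (m : ℕ) (_ : 1 ≤ m), (𝒜 m : Set A)))
    (L : Type u) [AddCommGroup L] [Module A L] [Module.Finite A L]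
    (ℒ : ℤ → AddSubgroup L) [DirectSum.Decomposition ℒ]
    (hLsmul : ∀ (m : ℕ) (j : ℤ), ∀ a ∈ 𝒜 m, ∀ x ∈ ℒ j, a • x ∈ ℒ ((m : ℤ) + j))
    (d : ℕ) (hdpos : 0 < d)
    (hdim : ringKrullDim (A ⧸ Module.annihilator A L) = (d : WithBot ℕ∞))
    (ℋ : ℤ → AddSubgroup ((localCohomology 𝔪 d).obj (ModuleCat.of A L)))
    [DirectSum.Decomposition ℋ]
    (hsmul : ∀ (m : ℕ) (j : ℤ), ∀ a ∈ 𝒜 m, ∀ x ∈ ℋ j, a • x ∈ ℋ ((m : ℤ) + j))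
    (aInv : ℤ) (ha : IsGreatest {j : ℤ | ℋ j ≠ ⊥} aInv) :
    ∀ j : ℤ, j ≤ aInv → ℋ j ≠ ⊥ := by
  obtain ⟨i, rfl⟩ := Nat.exists_eq_add_of_le' hdpos
  subst h𝔪
  intro j hj
  induction j, hj using Int.leInductionDown with
  | base => exact ha.1
  | pred j _ ih =>
    refine fun h ↦ ih ?_
    have := DirectSum.Decomposition.eq_bot_of_smul_top_eq_top 𝒜 hstd ℋ hsmul
      (localCohomology.smul_top_eq_top i L hdim.le) h
    rwa [sub_add_cancel] at this
end

section
/- Let k be a field and S = k[X₁,…,Xₙ,Y₁,…,Y_r] (n, r ≥ 1) the polynomial ring bigraded by deg X_i = (1,0) and deg Y_j = (d_j,1) with d_j ≥ 0 and d = max_j d_j. For positive integers c, e with c ≥ de+1, the diagonal subalgebra S_Δ = ⊕_{s≥0} S_{(cs,es)} (a k-subalgebra of S spanned by the monomials X^αY^β with Σα_i + Σd_jβ_j = cs and Σβ_j = es for some s ≥ 0) has Krull dimension n + r − 1. -/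
open MvPolynomial

/-- An integral extension preserves the Krull dimension. -/
theorem ringKrullDim_eq_of_isIntegral (R S : Type*) [CommRing R] [CommRing S] [Algebra R S]
    [FaithfulSMul R S] [Algebra.IsIntegral R S] : ringKrullDim S = ringKrullDim R := by
  apply le_antisymm
  · exact Order.krullDim_le_of_strictMono (PrimeSpectrum.comap (algebraMap R S))
      fun p q hpq ↦ Ideal.IsIntegral.comap_lt_comap hpq
  · refine iSup_le fun l ↦ ?_
    obtain ⟨P, hP, hPl⟩ := (inferInstance : Nonempty (l.head.asIdeal.primesOver S))
    obtain ⟨L, hL, -⟩ := Ideal.exists_ltSeries_of_hasGoingUp l P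
    exact hL ▸ le_iSup (fun p : LTSeries (PrimeSpectrum S) ↦ (p.length : WithBot ℕ∞)) L

/-- The Krull dimension of a finitely generated domain over a field is its transcendence degree. -/
theorem ringKrullDim_eq_of_trdeg_eq {k A : Type*} [Field k] [CommRing A] [IsDomain A] [Algebra k A]
    [Algebra.FiniteType k A] {m : ℕ} (h : Algebra.trdeg k A = m) :
    ringKrullDim A = (m : WithBot ℕ∞) := by
  obtain ⟨s, g, hg, hint⟩ := exists_integral_inj_algHom_of_fg k A
  let := g.toRingHom.toAlgebra
  have : IsScalarTower k (MvPolynomial (Fin s) k) A := .of_algHom g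
  have : FaithfulSMul (MvPolynomial (Fin s) k) A :=
    (faithfulSMul_iff_algebraMap_injective _ _).mpr hg
  have : Algebra.IsIntegral (MvPolynomial (Fin s) k) A := ⟨hint⟩
  have hs := lift_trdeg_add_eq k (MvPolynomial (Fin s) k) A
  simp only [MvPolynomial.trdeg_of_isDomain, trdeg_eq_zero, h,
    Cardinal.mk_fin, Cardinal.lift_natCast, Cardinal.lift_zero, add_zero, Nat.cast_inj] at hs
  rw [ringKrullDim_eq_of_isIntegral (MvPolynomial (Fin s) k) A,
    MvPolynomial.ringKrullDim_of_isNoetherianRing]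
  simp [hs]

/-- An element with a power equal to a fraction of elements of the base is algebraic. -/
theorem isAlgebraic_of_mul_pow_eq {R S : Type*} [CommRing R] [CommRing S] [Algebra R S]
    {a b : R} {x : S} {m : ℕ} (ha : a ≠ 0) (hm : m ≠ 0)
    (h : algebraMap R S a * x ^ m = algebraMap R S b) : IsAlgebraic R x := by
  refine ⟨.C a * .X ^ m - .C b, fun h0 ↦ ha ?_, by simp [h]⟩
  simpa [Polynomial.coeff_C, hm] using congrArg (Polynomial.coeff · m) h0

/-- The subalgebra of a polynomial ring spanned by the monomials with exponents in `M`. -/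
noncomputable def monomialSubalgebra (k : Type*) [Field k] {σ : Type*}
    (M : AddSubmonoid (σ →₀ ℕ)) : Subalgebra k (MvPolynomial σ k) :=
  Algebra.adjoin k ((fun α ↦ monomial α 1) '' (M : Set (σ →₀ ℕ)))

section monomialSubalgebra

variable {k : Type*} [Field k] {σ : Type*} {M : AddSubmonoid (σ →₀ ℕ)}

theorem monomial_mem_monomialSubalgebra {α : σ →₀ ℕ} (hα : α ∈ M) :
    monomial α (1 : k) ∈ monomialSubalgebra k M :=
  Algebra.subset_adjoin ⟨α, hα, rfl⟩

theorem finiteType_monomialSubalgebra (hM : M.FG) :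
    Algebra.FiniteType k (monomialSubalgebra k M) := by
  classical
  obtain ⟨F, rfl⟩ := hM
  rw [← Subalgebra.fg_iff_finiteType]
  refine ⟨F.image fun α ↦ monomial α 1, le_antisymm ?_ ?_⟩
  · refine Algebra.adjoin_mono ?_
    rw [Finset.coe_image]
    exact Set.image_mono AddSubmonoid.subset_closure
  · refine Algebra.adjoin_le ?_
    rintro _ ⟨α, hα, rfl⟩
    induction hα using AddSubmonoid.closure_induction with
    | mem x hx => exact Algebra.subset_adjoin (Finset.mem_coe.mpr (Finset.mem_image_of_mem _ hx))
    | zero => exact one_mem _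
    | add x y _ _ hx hy =>
      have : monomial (x + y) (1 : k) = monomial x 1 * monomial y 1 := by simp [monomial_mul]
      rw [SetLike.mem_coe] at hx hy ⊢
      simpa only [this] using mul_mem hx hy

theorem isWeightedHomogeneous_of_mem_monomialSubalgebra {w : σ → ℤ}
    (hw : ∀ α ∈ M, Finsupp.weight w α = 0) {p : MvPolynomial σ k}
    (hp : p ∈ monomialSubalgebra k M) : IsWeightedHomogeneous w p 0 := by
  induction hp using Algebra.adjoin_induction with
  | mem x hx =>
    obtain ⟨α, hα, rfl⟩ := hx
    exact isWeightedHomogeneous_monomial w α 1 (hw α hα)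
  | algebraMap r => exact isWeightedHomogeneous_C w r
  | add x y _ _ hx hy => exact hx.add hy
  | mul x y _ _ hx hy => simpa using hx.mul hy

theorem transcendental_X_of_weight {w : σ → ℤ} (hw : ∀ α ∈ M, Finsupp.weight w α = 0)
    {i : σ} (hi : w i ≠ 0) :
    Transcendental (monomialSubalgebra k M) (X i : MvPolynomial σ k) := by
  classical
  rw [transcendental_iff]
  intro p hp
  ext1 j
  rw [Polynomial.aeval_eq_sum_range] at hp
  have hhom (l : ℕ) :
      IsWeightedHomogeneous w (p.coeff l • (X i : MvPolynomial σ k) ^ l) (l • w i) := by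
    simpa [Subalgebra.smul_def] using
      (isWeightedHomogeneous_of_mem_monomialSubalgebra hw (p.coeff l).2).mul
        ((isWeightedHomogeneous_X k w i).pow l)
  by_cases hj : j ∈ Finset.range (p.natDegree + 1)
  · have h := congrArg (weightedHomogeneousComponent w (j • w i)) hp
    rw [map_sum, map_zero, Finset.sum_eq_single j, (hhom j).weightedHomogeneousComponent_same] at h
    · simpa [Subalgebra.smul_def] using h
    · intro l _ hl
      exact (hhom l).weightedHomogeneousComponent_ne _ (by simpa [hi] using hl.symm)
    · exact fun h ↦ absurd hj h
  · exact Polynomial.coeff_eq_zero_of_natDegree_lt (by simpa using hj)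

end monomialSubalgebra

/-- The exponents of the monomials whose bidegree lies on the diagonal spanned by `(c, e)`. -/
def diagonalExponents {n r : ℕ} (dvec : Fin r → ℕ) (c e : ℕ) :
    AddSubmonoid ((Fin n ⊕ Fin r) →₀ ℕ) where
  carrier := {α | ∃ s : ℕ, (∑ i, α (Sum.inl i)) + ∑ j, dvec j * α (Sum.inr j) = c * s ∧
    ∑ j, α (Sum.inr j) = e * s}
  zero_mem' := ⟨0, by simp⟩
  add_mem' := by
    rintro α β ⟨s, hs, hs'⟩ ⟨t, ht, ht'⟩
    refine ⟨s + t, ?_, ?_⟩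
    · simp only [Finsupp.add_apply, mul_add, Finset.sum_add_distrib, ← hs, ← ht]
      ring
    · simp only [Finsupp.add_apply, mul_add, Finset.sum_add_distrib, ← hs', ← ht']

section diagonalExponents

variable {n r : ℕ} {dvec : Fin r → ℕ} {c e : ℕ}

theorem fg_diagonalExponents : (diagonalExponents (n := n) dvec c e).FG := by
  let f : ((Fin n ⊕ Fin r) →₀ ℕ) × ℕ →+ ℕ × ℕ :=
    { toFun p := ((∑ i, p.1 (Sum.inl i)) + ∑ j, dvec j * p.1 (Sum.inr j), ∑ j, p.1 (Sum.inr j))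
      map_zero' := by simp
      map_add' p q := by
        simp only [Prod.fst_add, Finsupp.add_apply, mul_add, Finset.sum_add_distrib, Prod.mk_add_mk]
        congr 1
        ring }
  let g : ((Fin n ⊕ Fin r) →₀ ℕ) × ℕ →+ ℕ × ℕ :=
    { toFun p := (c * p.2, e * p.2)
      map_zero' := by simp
      map_add' p q := by simp [mul_add] }
  convert (AddSubmonoid.fg_eqLocusM f g).map (AddMonoidHom.fst _ _)
  ext α
  simp [diagonalExponents, f, g, AddMonoidHom.eqLocusM]

theorem weight_eq_zero_of_mem_diagonalExponents {α : (Fin n ⊕ Fin r) →₀ ℕ}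
    (hα : α ∈ diagonalExponents dvec c e) :
    Finsupp.weight (Sum.elim (fun _ ↦ (e : ℤ)) fun j ↦ (e : ℤ) * dvec j - c) α = 0 := by
  obtain ⟨s, hs, hs'⟩ := hα
  zify at hs hs'
  rw [Finsupp.weight_apply, Finsupp.sum_fintype _ _ (by simp)]
  simp only [Fintype.sum_sum_type, Sum.elim_inl, Sum.elim_inr, nsmul_eq_mul]
  have h₁ : ∑ i : Fin n, (α (Sum.inl i) : ℤ) * e = e * ∑ i : Fin n, (α (Sum.inl i) : ℤ) := by
    rw [Finset.mul_sum]; exact Finset.sum_congr rfl fun _ _ ↦ mul_comm _ _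
  have h₂ : ∑ j : Fin r, (α (Sum.inr j) : ℤ) * ((e : ℤ) * dvec j - c) =
      e * ∑ j : Fin r, (dvec j : ℤ) * α (Sum.inr j) - c * ∑ j : Fin r, (α (Sum.inr j) : ℤ) := by
    rw [Finset.mul_sum, Finset.mul_sum, ← Finset.sum_sub_distrib]
    exact Finset.sum_congr rfl fun _ _ ↦ by ring
  rw [h₁, h₂]
  linear_combination (e : ℤ) * hs - (c : ℤ) * hs'

theorem X_pow_mul_X_pow_mem {k : Type*} [Field k] (i : Fin n) (j : Fin r) (hj : dvec j * e ≤ c) :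
    (X (Sum.inl i) ^ (c - dvec j * e) * X (Sum.inr j) ^ e : MvPolynomial (Fin n ⊕ Fin r) k) ∈
      monomialSubalgebra k (diagonalExponents dvec c e) := by
  have h : (X (Sum.inl i) ^ (c - dvec j * e) * X (Sum.inr j) ^ e :
      MvPolynomial (Fin n ⊕ Fin r) k) =
      monomial (Finsupp.single (Sum.inl i) (c - dvec j * e) + Finsupp.single (Sum.inr j) e) 1 := by
    simp [X_pow_eq_monomial, monomial_mul]
  rw [h]
  refine monomial_mem_monomialSubalgebra ⟨1, ?_, ?_⟩
  · rw [Finset.sum_eq_single i (by simp +contextual [eq_comm]) (by simp)]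
    simp [Finsupp.single_apply, hj]
  · simp [Finsupp.single_apply]

/-- Over the diagonal subalgebra, the polynomial ring is algebraic after adjoining one of the
variables of bidegree `(1, 0)`. -/
theorem isAlgebraic_adjoin_X_monomialSubalgebra {k : Type*} [Field k] (i₀ : Fin n) (j₀ : Fin r)
    (he : e ≠ 0) (hc : ∀ j, dvec j * e < c) :
    Algebra.IsAlgebraic
      (Algebra.adjoin (monomialSubalgebra k (diagonalExponents (n := n) dvec c e))
        {(X (Sum.inl i₀) : MvPolynomial (Fin n ⊕ Fin r) k)})
      (MvPolynomial (Fin n ⊕ Fin r) k) := by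
  set A := monomialSubalgebra k (diagonalExponents (n := n) dvec c e)
  set B := Algebra.adjoin A {(X (Sum.inl i₀) : MvPolynomial (Fin n ⊕ Fin r) k)}
  have hA {p} (hp : p ∈ A) : p ∈ B := B.algebraMap_mem ⟨p, hp⟩
  have hX : (X (Sum.inl i₀) : MvPolynomial (Fin n ⊕ Fin r) k) ∈ B :=
    Algebra.subset_adjoin rfl
  have hmem (i j) := hA (X_pow_mul_X_pow_mem (k := k) (n := n) i j (hc j).le)
  have hvar (v) : IsAlgebraic B (X v : MvPolynomial (Fin n ⊕ Fin r) k) := by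
    rcases v with i | j
    · refine isAlgebraic_of_mul_pow_eq (a := ⟨_, hmem i₀ j₀⟩)
        (b := ⟨_, mul_mem (pow_mem hX (c - dvec j₀ * e)) (hmem i j₀)⟩) (m := c - dvec j₀ * e)
        (by simp [Subtype.ext_iff, X_ne_zero]) (Nat.sub_pos_of_lt (hc j₀)).ne' ?_
      simp only [Subalgebra.algebraMap_def, Algebra.algebraMap_self, RingHom.id_apply]
      ring
    · refine isAlgebraic_of_mul_pow_eq (a := ⟨_, pow_mem hX (c - dvec j * e)⟩)
        (b := ⟨_, hmem i₀ j⟩) (m := e) (by simp [Subtype.ext_iff, X_ne_zero]) he ?_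
      simp only [Subalgebra.algebraMap_def, Algebra.algebraMap_self, RingHom.id_apply]
  refine ⟨fun p ↦ ?_⟩
  induction p using MvPolynomial.induction_on with
  | C a => exact isAlgebraic_algebraMap (⟨C a, hA (A.algebraMap_mem a)⟩ : B)
  | add p q hp hq => exact hp.add hq
  | mul_X p v hp => exact hp.mul (hvar v)

end diagonalExponents

/-- For the bigraded polynomial ring `S = k[X₁,…,Xₙ,Y₁,…,Y_r]` with `deg Xᵢ = (1,0)`,
`deg Yⱼ = (dⱼ,1)` and a diagonal `Δ = (c,e)` with `c ≥ (max dⱼ)e + 1`, the diagonal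
subalgebra `S_Δ` (the `k`-subalgebra spanned by the monomials `X^αY^β` with
`Σαᵢ + Σdⱼβⱼ = cs` and `Σβⱼ = es` for some `s ≥ 0`) has Krull dimension `n + r - 1`. -/
theorem stmt16 {k : Type*} [Field k]
    (n r : ℕ) (hn : 1 ≤ n) (hr : 1 ≤ r)
    (dvec : Fin r → ℕ) (d : ℕ) (hd : d = Finset.univ.sup dvec)
    (c e : ℕ) (hc : 0 < c) (he : 0 < e) (hcde : d * e + 1 ≤ c) :
    ringKrullDim (Algebra.adjoin k
      {p : MvPolynomial (Fin n ⊕ Fin r) k |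
        ∃ (α : (Fin n ⊕ Fin r) →₀ ℕ) (s : ℕ),
          p = monomial α 1 ∧
          ((∑ i, α (Sum.inl i)) + ∑ j, dvec j * α (Sum.inr j) = c * s) ∧
          ((∑ j, α (Sum.inr j)) = e * s)}) = ((n + r - 1 : ℕ) : WithBot ℕ∞) := by
  have hset : {p : MvPolynomial (Fin n ⊕ Fin r) k |
        ∃ (α : (Fin n ⊕ Fin r) →₀ ℕ) (s : ℕ),
          p = monomial α 1 ∧
          ((∑ i, α (Sum.inl i)) + ∑ j, dvec j * α (Sum.inr j) = c * s) ∧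
          ((∑ j, α (Sum.inr j)) = e * s)} =
      (fun α ↦ monomial α 1) '' (diagonalExponents (n := n) dvec c e : Set _) := by
    ext p
    constructor
    · rintro ⟨α, s, rfl, h⟩
      exact ⟨α, ⟨s, h⟩, rfl⟩
    · rintro ⟨α, ⟨s, h⟩, rfl⟩
      exact ⟨α, s, rfl, h⟩
  rw [hset]
  change ringKrullDim (monomialSubalgebra k (diagonalExponents (n := n) dvec c e)) = _
  set A := monomialSubalgebra k (diagonalExponents (n := n) dvec c e)
  have : Algebra.FiniteType k A := finiteType_monomialSubalgebra fg_diagonalExponents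
  have hdc (j) : dvec j * e < c :=
    (Nat.mul_le_mul_right e (hd ▸ Finset.le_sup (Finset.mem_univ j))).trans_lt hcde
  have := isAlgebraic_adjoin_X_monomialSubalgebra (k := k) (n := n) ⟨0, hn⟩ ⟨0, hr⟩ he.ne' hdc
  have hle : Algebra.trdeg A (MvPolynomial (Fin n ⊕ Fin r) k) ≤ 1 :=
    (Algebra.IsAlgebraic.trdeg_le_cardinalMk A {X (Sum.inl ⟨0, hn⟩)}).trans (by simp)
  have htr : Transcendental A (X (Sum.inl ⟨0, hn⟩) : MvPolynomial (Fin n ⊕ Fin r) k) :=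
    transcendental_X_of_weight (fun _ ↦ weight_eq_zero_of_mem_diagonalExponents)
      (by simpa using he.ne')
  have : Algebra.Transcendental A (MvPolynomial (Fin n ⊕ Fin r) k) := ⟨_, htr⟩
  have hone : Algebra.trdeg A (MvPolynomial (Fin n ⊕ Fin r) k) = 1 :=
    hle.antisymm (Cardinal.one_le_iff_pos.mpr (trdeg_pos _ _))
  have hadd := trdeg_add_eq k A (A := MvPolynomial (Fin n ⊕ Fin r) k)
  rw [hone, MvPolynomial.trdeg_of_isDomain] at hadd
  refine ringKrullDim_eq_of_trdeg_eq (k := k) (Cardinal.add_one_inj.mp (hadd.trans ?_))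
  have : n + r - 1 + 1 = n + r := by lia
  simp only [Cardinal.mk_sum, Cardinal.mk_fin, Cardinal.lift_natCast, ← Nat.cast_add,
    ← Nat.cast_add_one, this]
end
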